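/- Let a > 0, l ∈ ℕ₀, n ∈ ℕ, and let f : ℝⁿ → ℂ be C^l with f(x) = O(|x|^{-a}). Let α ∈ ℂ with 0 < Re α < a and α ∉ n + 2ℕ₀. Then I^α f is C^l on ℝⁿ. Moreover, for any x ∈ ℝⁿ and 0 < ε < 1: if every l-th order partial derivative of f is Hölder continuous of index ε on some neighborhood of x, then every l-th order partial derivative of I^α f is Hölder continuous of index ε on some neighborhood of x. -/

import Mathlib

open Complex MeasureTheory Filter Asymptotics Set Metric

/-- `H_n(α) = 2^α π^(n/2) Γ(α/2) / Γ((n-α)/2)`. -/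
noncomputable def Hfun (n : ℕ) (α : ℂ) : ℂ :=
  (2 : ℂ) ^ α * (Real.pi : ℂ) ^ ((n : ℂ) / 2) * Complex.Gamma (α / 2) /
    Complex.Gamma (((n : ℂ) - α) / 2)

/-- The Riesz potential `(I^α f)(x) = (1/H_n(α)) ∫_{ℝⁿ} f(y) |x-y|^{α-n} dy`. -/
noncomputable def riesz (n : ℕ) (f : EuclideanSpace ℝ (Fin n) → ℂ) (α : ℂ)
    (x : EuclideanSpace ℝ (Fin n)) : ℂ :=
  (Hfun n α)⁻¹ * ∫ y : EuclideanSpace ℝ (Fin n), f y * (‖x - y‖ : ℂ) ^ (α - n)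

open scoped Topology

section WeightedTranslates

variable {E : Type*} [NormedAddCommGroup E] [NormedSpace ℝ E] [FiniteDimensional ℝ E]
  [MeasurableSpace E] [BorelSpace E] {μ : Measure E}

/-- The weighted translates of `F` and of its derivatives up to order `N` are locally uniformly
dominated by integrable functions. -/
def DominatedTranslates (μ : Measure E) (N : ℕ) (w F : E → ℂ) : Prop :=
  ∀ m ≤ N, ∀ x₀ : E, ∃ b : E → ℝ, Integrable b μ ∧
    ∀ x ∈ ball x₀ 1, ∀ y, ‖w y‖ * ‖iteratedFDeriv ℝ m F (x - y)‖ ≤ b y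

variable {N : ℕ} {w F : E → ℂ}

theorem DominatedTranslates.integrable_iteratedFDeriv (hb : DominatedTranslates μ N w F)
    (hw : AEStronglyMeasurable w μ) (hF : ContDiff ℝ N F) {m : ℕ} (hm : m ≤ N) (x : E) :
    Integrable (fun y ↦ w y • iteratedFDeriv ℝ m F (x - y)) μ := by
  obtain ⟨b, hbi, hb⟩ := hb m hm x
  have hc : Continuous (iteratedFDeriv ℝ m F) :=
    hF.continuous_iteratedFDeriv (by exact_mod_cast hm)
  refine hbi.mono' (hw.smul (hc.comp
    (continuous_const.sub continuous_id)).aestronglyMeasurable) (ae_of_all _ fun y ↦ ?_)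
  rw [norm_smul]
  exact hb x (mem_ball_self one_pos) y

theorem DominatedTranslates.integrable (hb : DominatedTranslates μ N w F)
    (hw : AEStronglyMeasurable w μ) (hF : ContDiff ℝ N F) (x : E) :
    Integrable (fun y ↦ w y • F (x - y)) μ := by
  refine (hb.integrable_iteratedFDeriv hw hF N.zero_le x).mono (hw.smul
    (hF.continuous.comp (continuous_const.sub continuous_id)).aestronglyMeasurable)
    (ae_of_all _ fun y ↦ ?_)
  simp only [norm_smul, norm_iteratedFDeriv_zero, le_refl]

/-- Differentiation under the integral sign for weighted integrals of translates. -/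
theorem DominatedTranslates.hasFTaylorSeriesUpTo_integral (hb : DominatedTranslates μ N w F)
    (hw : AEStronglyMeasurable w μ) (hF : ContDiff ℝ N F) :
    HasFTaylorSeriesUpTo N (fun x ↦ ∫ y, w y • F (x - y) ∂μ)
      (fun x m ↦ ∫ y, w y • iteratedFDeriv ℝ m F (x - y) ∂μ) := by
  have hcont : ∀ m ≤ N, Continuous (iteratedFDeriv ℝ m F) := fun m hm ↦
    hF.continuous_iteratedFDeriv (by exact_mod_cast hm)
  have hint : ∀ m ≤ N, ∀ x, Integrable (fun y ↦ w y • iteratedFDeriv ℝ m F (x - y)) μ :=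
    fun m hm x ↦ hb.integrable_iteratedFDeriv hw hF hm x
  have hmeas : ∀ m ≤ N, ∀ x,
      AEStronglyMeasurable (fun y ↦ w y • iteratedFDeriv ℝ m F (x - y)) μ := fun m hm x ↦
    (hint m hm x).aestronglyMeasurable
  refine ⟨fun x ↦ ?_, fun m hm x₀ ↦ ?_, fun m hm ↦ ?_⟩
  · rw [ContinuousMultilinearMap.curry0_apply,
      ContinuousMultilinearMap.integral_apply (hint 0 N.zero_le x)]
    simp
  · have hm : m < N := by exact_mod_cast hm
    obtain ⟨b, hbi, hb⟩ := hb (m + 1) hm x₀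
    have key := hasFDerivAt_integral_of_dominated_of_fderiv_le (𝕜 := ℝ) (μ := μ)
      (F := fun x y ↦ w y • iteratedFDeriv ℝ m F (x - y))
      (F' := fun x y ↦ continuousMultilinearCurryLeftEquiv ℝ (fun _ : Fin (m + 1) ↦ E) ℂ
        (w y • iteratedFDeriv ℝ (m + 1) F (x - y)))
      (x₀ := x₀) (bound := b) (ball_mem_nhds x₀ one_pos)
      (Eventually.of_forall fun x ↦ hmeas m hm.le x) (hint m hm.le x₀)
      ((LinearIsometryEquiv.continuous _).comp_aestronglyMeasurable (hmeas (m + 1) hm x₀))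
      (ae_of_all _ fun y x hx ↦ ?_) hbi (ae_of_all _ fun y x _ ↦ ?_)
    · refine key.congr_fderiv ?_
      exact (ContinuousLinearEquiv.integral_comp_comm (μ := μ) (𝕜 := ℝ) (E := E [×(m + 1)]→L[ℝ] ℂ)
        (F := E →L[ℝ] (E [×m]→L[ℝ] ℂ)) (continuousMultilinearCurryLeftEquiv ℝ
          (fun _ : Fin (m + 1) ↦ E) ℂ).toContinuousLinearEquiv
        (fun y ↦ w y • iteratedFDeriv ℝ (m + 1) F (x₀ - y)))
    · rw [LinearIsometryEquiv.norm_map, norm_smul]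
      exact hb x hx y
    · have hd : HasFDerivAt (iteratedFDeriv ℝ m F)
          (continuousMultilinearCurryLeftEquiv ℝ (fun _ : Fin (m + 1) ↦ E) ℂ
            (iteratedFDeriv ℝ (m + 1) F (x - y))) (x - y) :=
        (hF.differentiable_iteratedFDeriv (by exact_mod_cast hm) (x - y)).hasFDerivAt
      exact ((hasFDerivAt_comp_sub y).2 hd).const_smul (w y)
  · have hm : m ≤ N := by exact_mod_cast hm
    refine continuous_iff_continuousAt.2 fun x₀ ↦ ?_
    obtain ⟨b, hbi, hb⟩ := hb m hm x₀
    refine continuousAt_of_dominated (bound := b) (Eventually.of_forall fun x ↦ hmeas m hm x)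
      ?_ hbi (ae_of_all _ fun y ↦ ?_)
    · filter_upwards [ball_mem_nhds x₀ one_pos] with x hx
      refine ae_of_all _ fun y ↦ ?_
      rw [norm_smul]
      exact hb x hx y
    · exact (((hcont m hm).comp (continuous_id.sub continuous_const)).const_smul
        (w y)).continuousAt

end WeightedTranslates

theorem Real.rpow_le_rpow_abs_mul_rpow {A v w : ℝ} (hA : 1 ≤ A) (hv : 0 < v) (hw : 0 < w)
    (hvw : v ≤ A * w) (hwv : w ≤ A * v) (s : ℝ) : v ^ s ≤ A ^ |s| * w ^ s := by
  have hA0 : 0 < A := one_pos.trans_le hA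
  rcases le_total 0 s with hs | hs
  · rw [abs_of_nonneg hs, ← Real.mul_rpow hA0.le hw.le]
    exact Real.rpow_le_rpow hv.le hvw hs
  · rw [abs_of_nonpos hs, Real.rpow_neg hA0.le, ← Real.inv_rpow hA0.le,
      ← Real.mul_rpow (inv_nonneg.2 hA0.le) hw.le]
    refine Real.rpow_le_rpow_of_nonpos (by positivity) ?_ hs
    rw [inv_mul_le_iff₀ hA0]
    exact hwv

theorem norm_ofReal_norm_cpow {E : Type*} [NormedAddCommGroup E] {z : E} (hz : z ≠ 0) (β : ℂ) :
    ‖(‖z‖ : ℂ) ^ β‖ = ‖z‖ ^ β.re :=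
  norm_cpow_eq_rpow_re_of_pos (norm_pos_iff.2 hz) β

section Kernel

variable {E : Type*} [NormedAddCommGroup E] [InnerProductSpace ℝ E]

theorem contDiffAt_ofReal_norm_cpow {k : WithTop ℕ∞} {z : E} (hz : z ≠ 0) (β : ℂ) :
    ContDiffAt ℝ k (fun z : E ↦ (‖z‖ : ℂ) ^ β) z := by
  have h : ContDiffAt ℝ k (fun z : E ↦ Complex.exp ((Real.log ‖z‖ : ℝ) * β)) z :=
    ((Complex.ofRealCLM.contDiff.contDiffAt.comp z
      ((contDiffAt_norm ℝ hz).log (norm_ne_zero_iff.2 hz))).mul contDiffAt_const).cexp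
  refine h.congr_of_eventuallyEq ?_
  filter_upwards [isOpen_ne.mem_nhds hz] with y hy
  rw [Complex.cpow_def_of_ne_zero (by exact_mod_cast norm_ne_zero_iff.2 hy),
    Complex.ofReal_log (norm_nonneg y)]

variable [FiniteDimensional ℝ E] (χ : ContDiffBump (0 : E))

/-- The part of the kernel `‖z‖ ^ β` away from the origin, which is smooth. -/
noncomputable def farKernel (β : ℂ) (z : E) : ℂ := (1 - χ z : ℝ) * (‖z‖ : ℂ) ^ β

/-- The part of the kernel `‖z‖ ^ β` near the origin, which has compact support. -/
noncomputable def nearKernel (β : ℂ) (z : E) : ℂ := (χ z : ℝ) * (‖z‖ : ℂ) ^ β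

theorem nearKernel_add_farKernel (β : ℂ) (z : E) :
    nearKernel χ β z + farKernel χ β z = (‖z‖ : ℂ) ^ β := by
  simp only [nearKernel, farKernel]
  push_cast
  ring

theorem nearKernel_eq_zero {β : ℂ} {z : E} (hz : χ.rOut ≤ ‖z‖) : nearKernel χ β z = 0 := by
  rw [nearKernel, χ.zero_of_le_dist (by simpa using hz)]
  simp

theorem contDiff_farKernel {k : ℕ∞} (β : ℂ) : ContDiff ℝ k (farKernel χ β) := by
  refine contDiff_iff_contDiffAt.2 fun z ↦ ?_
  rcases eq_or_ne z 0 with rfl | hz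
  · refine (contDiffAt_const (c := (0 : ℂ))).congr_of_eventuallyEq ?_
    filter_upwards [χ.eventuallyEq_one] with y hy
    simp only [Pi.one_apply] at hy
    simp [farKernel, hy]
  · exact (Complex.ofRealCLM.contDiff.contDiffAt.comp z
      (contDiffAt_const.sub χ.contDiffAt)).mul (contDiffAt_ofReal_norm_cpow hz β)

theorem norm_iteratedFDeriv_farKernel_eq (β : ℂ) (m : ℕ) {t : ℝ} (ht : 0 < t) {u : E}
    (hu : χ.rOut < ‖u‖) (htu : χ.rOut < ‖t • u‖) :
    t ^ m * ‖iteratedFDeriv ℝ m (farKernel χ β) (t • u)‖ =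
      t ^ β.re * ‖iteratedFDeriv ℝ m (farKernel χ β) u‖ := by
  have hout : ∀ z : E, χ.rOut < ‖z‖ → farKernel χ β z = (‖z‖ : ℂ) ^ β := fun z hz ↦ by
    rw [farKernel, χ.zero_of_le_dist (by simpa using hz.le)]
    simp
  have heq : (fun w ↦ farKernel χ β (t • w)) =ᶠ[𝓝 u] (t : ℂ) ^ β • farKernel χ β := by
    have h1 : ∀ᶠ w in 𝓝 u, χ.rOut < ‖w‖ := continuous_norm.continuousAt.eventually_const_lt hu
    have h2 : ∀ᶠ w in 𝓝 u, χ.rOut < ‖t • w‖ :=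
      (continuous_norm.comp (continuous_const_smul t)).continuousAt.eventually_const_lt htu
    filter_upwards [h1, h2] with w hw htw
    rw [Pi.smul_apply, hout _ hw, hout _ htw, norm_smul, Real.norm_of_nonneg ht.le,
      Complex.ofReal_mul, Complex.mul_cpow_ofReal_nonneg ht.le (norm_nonneg w), smul_eq_mul]
  have h := heq.iteratedFDeriv ℝ m |>.eq_of_nhds
  have hs : ContDiff ℝ m (farKernel χ β) := contDiff_farKernel (k := m) χ β
  rw [iteratedFDeriv_const_smul_apply hs.contDiffAt] at h
  have h' := congrArg norm h
  rw [iteratedFDeriv_comp_const_smul t hs] at h'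
  rw [norm_smul, norm_smul, norm_pow, Real.norm_of_nonneg ht.le,
    norm_cpow_eq_rpow_re_of_pos ht] at h'
  exact h'

theorem exists_norm_iteratedFDeriv_farKernel_le (β : ℂ) (m : ℕ) :
    ∃ C : ℝ, 0 ≤ C ∧ ∀ z : E,
      ‖iteratedFDeriv ℝ m (farKernel χ β) z‖ ≤ C * (1 + ‖z‖) ^ β.re := by
  set R := χ.rOut with hR
  have hR0 : 0 < R := χ.rOut_pos
  have hs : ContDiff ℝ m (farKernel χ β) := contDiff_farKernel (k := m) χ β
  obtain ⟨C, hC⟩ := (isCompact_closedBall (0 : E) (2 * R)).exists_bound_of_continuousOn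
    (hs.continuous_iteratedFDeriv le_rfl).continuousOn
  have hC0 : 0 ≤ C := (norm_nonneg _).trans (hC 0 (mem_closedBall_self (by positivity)))
  set A := 1 + 2 * R + (2 * R)⁻¹ with hA
  have hA1 : 1 ≤ A := by
    have : 0 < (2 * R)⁻¹ := by positivity
    linarith
  have hscale : ∀ t z : ℝ, 1 ≤ t → z ≤ 2 * R * t → (t = 1 ∨ z = 2 * R * t) → 0 ≤ z →
      t ^ β.re ≤ A ^ |β.re| * (1 + z) ^ β.re := by
    intro t z ht hz htz hz0
    have hi : 0 < (2 * R)⁻¹ := by positivity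
    refine Real.rpow_le_rpow_abs_mul_rpow hA1 (by positivity) (by positivity) ?_ ?_ _
    · rcases htz with rfl | rfl
      · nlinarith
      · have : (2 * R)⁻¹ * (2 * R * t) = t := by field_simp
        have h2 : 0 ≤ (1 + 2 * R) * (1 + 2 * R * t) := by positivity
        rw [hA]
        nlinarith
    · rw [hA]
      have : 0 < (2 * R)⁻¹ * t := by positivity
      nlinarith
  refine ⟨C * A ^ |β.re|, by positivity, fun z ↦ ?_⟩
  rcases le_or_gt ‖z‖ (2 * R) with hz | hz
  · have := hscale 1 ‖z‖ le_rfl (by simpa using hz) (Or.inl rfl) (norm_nonneg z)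
    rw [Real.one_rpow] at this
    calc _ ≤ C * 1 := by simpa using hC z (by simpa using hz)
      _ ≤ C * (A ^ |β.re| * (1 + ‖z‖) ^ β.re) := by gcongr
      _ = _ := by ring
  · set t := ‖z‖ / (2 * R) with ht
    have ht1 : 1 ≤ t := by rw [ht, one_le_div (by positivity)]; exact hz.le
    have ht0 : 0 < t := one_pos.trans_le ht1
    have hzt : ‖z‖ = 2 * R * t := by rw [ht]; field_simp
    have hu : ‖t⁻¹ • z‖ = 2 * R := by
      rw [norm_smul, norm_inv, Real.norm_of_nonneg ht0.le, hzt]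
      field_simp
    have htu : t • t⁻¹ • z = z := smul_inv_smul₀ ht0.ne' z
    have h := norm_iteratedFDeriv_farKernel_eq χ β m ht0 (u := t⁻¹ • z)
      (by rw [hu]; linarith) (by rw [htu]; linarith)
    rw [htu] at h
    calc ‖iteratedFDeriv ℝ m (farKernel χ β) z‖
        ≤ t ^ m * ‖iteratedFDeriv ℝ m (farKernel χ β) z‖ :=
          le_mul_of_one_le_left (norm_nonneg _) (one_le_pow₀ ht1)
      _ = t ^ β.re * ‖iteratedFDeriv ℝ m (farKernel χ β) (t⁻¹ • z)‖ := h
      _ ≤ t ^ β.re * C := by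
          gcongr
          exact hC _ (by simpa using hu.le)
      _ ≤ (A ^ |β.re| * (1 + ‖z‖) ^ β.re) * C := by
          gcongr
          exact hscale t ‖z‖ ht1 hzt.le (Or.inr hzt) (norm_nonneg z)
      _ = _ := by ring

variable [MeasurableSpace E] [BorelSpace E] {μ : Measure E} [μ.IsAddHaarMeasure]

theorem integrable_nearKernel {β : ℂ} (hd : 1 ≤ Module.finrank ℝ E)
    (hβ : -(Module.finrank ℝ E : ℝ) < β.re) : Integrable (nearKernel χ β) μ := by
  have : Nontrivial E := Module.nontrivial_of_finrank_pos (R := ℝ) hd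
  have hmeas : Measurable fun z : E ↦ (‖z‖ : ℂ) ^ β := by fun_prop
  have hae : ∀ᵐ z : E ∂μ, z ≠ 0 := by simp [ae_iff]
  have hloc : LocallyIntegrable (fun z : E ↦ (‖z‖ : ℂ) ^ β) μ := by
    refine locallyIntegrable_of_norm_le_rpow (C := 1) (α := -β.re) hd (by linarith) ?_
      hmeas.aestronglyMeasurable
    filter_upwards [hae] with z hz
    rw [norm_ofReal_norm_cpow hz, neg_neg, one_mul]
  have hc : Continuous fun z ↦ ((χ z : ℝ) : ℂ) := Complex.continuous_ofReal.comp χ.continuous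
  refine (hloc.integrable_smul_left_of_hasCompactSupport hc
    (χ.hasCompactSupport.comp_left Complex.ofReal_zero) : _)

end Kernel

section Decay

variable {E : Type*} [NormedAddCommGroup E] [ProperSpace E]

theorem exists_norm_le_mul_one_add_norm_rpow {f : E → ℂ} (hf : Continuous f) {a : ℝ}
    (hdecay : f =O[cocompact E] fun y ↦ ‖y‖ ^ (-a)) :
    ∃ C : ℝ, ∀ y, ‖f y‖ ≤ C * (1 + ‖y‖) ^ (-a) := by
  obtain ⟨C, hC0, hC⟩ := hdecay.exists_nonneg
  have h1 : ∀ᶠ y : E in cocompact E, 1 ≤ ‖y‖ := tendsto_norm_cocompact_atTop.eventually_ge_atTop 1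
  obtain ⟨K, hK, hKs⟩ := mem_cocompact.1 (hC.bound.and h1)
  obtain ⟨D, hD⟩ := hK.exists_bound_of_continuousOn (f := fun y ↦ ‖f y‖ * (1 + ‖y‖) ^ a)
    (hf.norm.mul ((continuous_const.add continuous_norm).rpow_const
      fun y ↦ Or.inl (add_pos_of_pos_of_nonneg one_pos (norm_nonneg y)).ne')).continuousOn
  refine ⟨max D (C * 2 ^ |-a|), fun y ↦ ?_⟩
  have hy : 0 < 1 + ‖y‖ := by positivity
  by_cases hyK : y ∈ K
  · have h := (le_abs_self _).trans (hD y hyK)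
    calc ‖f y‖ = (‖f y‖ * (1 + ‖y‖) ^ a) * (1 + ‖y‖) ^ (-a) := by
          rw [mul_assoc, ← Real.rpow_add hy]
          simp
      _ ≤ _ := by
          gcongr
          exact h.trans (le_max_left _ _)
  · obtain ⟨h, hy1⟩ := hKs hyK
    have h2 : ‖y‖ ^ (-a) ≤ 2 ^ |-a| * (1 + ‖y‖) ^ (-a) :=
      Real.rpow_le_rpow_abs_mul_rpow one_le_two (by linarith) hy (by linarith) (by linarith) _
    rw [Real.norm_of_nonneg (Real.rpow_nonneg (norm_nonneg y) _)] at h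
    calc ‖f y‖ ≤ C * ‖y‖ ^ (-a) := h
      _ ≤ C * (2 ^ |-a| * (1 + ‖y‖) ^ (-a)) := by gcongr
      _ = C * 2 ^ |-a| * (1 + ‖y‖) ^ (-a) := by ring
      _ ≤ _ := by
          gcongr
          exact le_max_right _ _

end Decay

section Convolution

variable {E : Type*} [NormedAddCommGroup E] [InnerProductSpace ℝ E] [FiniteDimensional ℝ E]
  [MeasurableSpace E] [BorelSpace E] {μ : Measure E} [μ.IsAddHaarMeasure]
  (χ : ContDiffBump (0 : E))

theorem dominatedTranslates_farKernel {f : E → ℂ} {a C : ℝ} {β : ℂ} (N : ℕ)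
    (hf : ∀ y, ‖f y‖ ≤ C * (1 + ‖y‖) ^ (-a)) (hβ : β.re + Module.finrank ℝ E < a) :
    DominatedTranslates μ N f (farKernel χ β) := by
  intro m _ x₀
  obtain ⟨D, hD0, hD⟩ := exists_norm_iteratedFDeriv_farKernel_le χ β m
  set A := 2 + ‖x₀‖ with hA
  have hA2 : 2 ≤ A := by simp [hA]
  have hC0 : 0 ≤ C := by simpa using (norm_nonneg _).trans (hf 0)
  refine ⟨fun y ↦ (C * D * A ^ |β.re|) * (1 + ‖y‖) ^ (-(a - β.re)),
    (integrable_one_add_norm (by linarith)).const_mul _, fun x hx y ↦ ?_⟩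
  have hy : 0 < 1 + ‖y‖ := by positivity
  have hxA : ‖x‖ ≤ A - 1 := by
    have h1 := norm_sub_norm_le x x₀
    rw [mem_ball_iff_norm] at hx
    linarith
  have h1 : ‖x - y‖ ≤ ‖x‖ + ‖y‖ := norm_sub_le x y
  have h2 : ‖y‖ ≤ ‖x‖ + ‖x - y‖ := by simpa using norm_sub_le x (x - y)
  have hPeetre : (1 + ‖x - y‖) ^ β.re ≤ A ^ |β.re| * (1 + ‖y‖) ^ β.re := by
    refine Real.rpow_le_rpow_abs_mul_rpow (by linarith) (by positivity) hy ?_ ?_ _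
    · nlinarith [norm_nonneg y]
    · nlinarith [norm_nonneg (x - y)]
  calc ‖f y‖ * ‖iteratedFDeriv ℝ m (farKernel χ β) (x - y)‖
      ≤ (C * (1 + ‖y‖) ^ (-a)) * (D * (A ^ |β.re| * (1 + ‖y‖) ^ β.re)) := by
        refine mul_le_mul (hf y) ((hD _).trans ?_) (norm_nonneg _) (by positivity)
        gcongr
    _ = (C * D * A ^ |β.re|) * ((1 + ‖y‖) ^ (-a) * (1 + ‖y‖) ^ β.re) := by ring
    _ = _ := by
        rw [← Real.rpow_add hy]
        ring_nf

omit [BorelSpace E] [μ.IsAddHaarMeasure] in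
theorem dominatedTranslates_nearKernel {f : E → ℂ} {β : ℂ} {N : ℕ} (hf : ContDiff ℝ N f)
    (hk : Integrable (nearKernel χ β) μ) :
    DominatedTranslates μ N (nearKernel χ β) f := by
  intro m hm x₀
  have hc : Continuous (iteratedFDeriv ℝ m f) :=
    hf.continuous_iteratedFDeriv (by exact_mod_cast hm)
  obtain ⟨C, hC⟩ := (isCompact_closedBall x₀ (1 + χ.rOut)).exists_bound_of_continuousOn
    hc.continuousOn
  refine ⟨fun y ↦ ‖nearKernel χ β y‖ * C, hk.norm.mul_const C, fun x hx y ↦ ?_⟩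
  rcases le_or_gt χ.rOut ‖y‖ with hy | hy
  · simp [nearKernel_eq_zero χ hy]
  · refine mul_le_mul_of_nonneg_left (hC _ ?_) (norm_nonneg _)
    rw [mem_ball_iff_norm] at hx
    rw [mem_closedBall_iff_norm]
    calc ‖x - y - x₀‖ = ‖(x - x₀) - y‖ := by congr 1; abel
      _ ≤ ‖x - x₀‖ + ‖y‖ := norm_sub_le _ _
      _ ≤ _ := by linarith

theorem integral_mul_norm_cpow_eq {f : E → ℂ} {β : ℂ} {N : ℕ} (hf : ContDiff ℝ N f)
    (hk : Integrable (nearKernel χ β) μ)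
    (hfar : DominatedTranslates μ N f (farKernel χ β)) (x : E) :
    ∫ y, f y * (‖x - y‖ : ℂ) ^ β ∂μ =
      (∫ y, nearKernel χ β y • f (x - y) ∂μ) + ∫ y, f y • farKernel χ β (x - y) ∂μ := by
  have hnear := (dominatedTranslates_nearKernel χ hf hk).integrable hk.aestronglyMeasurable hf x
  have hnear' := hnear.comp_sub_left x
  have hfar' := hfar.integrable hf.continuous.aestronglyMeasurable
    (contDiff_farKernel (k := N) χ β) x
  rw [← integral_sub_left_eq_self (fun y ↦ nearKernel χ β y • f (x - y)) μ x,
    ← integral_add hnear' hfar']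
  refine integral_congr_ae (ae_of_all _ fun y ↦ ?_)
  simp only [sub_sub_cancel, smul_eq_mul, ← nearKernel_add_farKernel χ β (x - y)]
  ring

end Convolution

section Holder

variable {E G : Type*} [NormedAddCommGroup E] [NormedAddCommGroup G]

/-- `g` is Hölder continuous of index `ε` on some neighbourhood of `x`. -/
def HolderNear (g : E → G) (ε : ℝ) (x : E) : Prop :=
  ∃ (O : Set E) (M : ℝ), IsOpen O ∧ x ∈ O ∧
    ∀ x₁ ∈ O, ∀ x₂ ∈ O, ‖g x₁ - g x₂‖ ≤ M * ‖x₁ - x₂‖ ^ ε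

theorem HolderNear.add {g h : E → G} {ε : ℝ} {x : E} (hg : HolderNear g ε x)
    (hh : HolderNear h ε x) : HolderNear (g + h) ε x := by
  obtain ⟨O, M, hO, hx, hM⟩ := hg
  obtain ⟨O', M', hO', hx', hM'⟩ := hh
  refine ⟨O ∩ O', M + M', hO.inter hO', ⟨hx, hx'⟩, fun x₁ h₁ x₂ h₂ ↦ ?_⟩
  calc ‖(g + h) x₁ - (g + h) x₂‖ = ‖(g x₁ - g x₂) + (h x₁ - h x₂)‖ := by
        rw [Pi.add_apply, Pi.add_apply, add_sub_add_comm]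
    _ ≤ M * ‖x₁ - x₂‖ ^ ε + M' * ‖x₁ - x₂‖ ^ ε :=
        norm_add_le_of_le (hM x₁ h₁.1 x₂ h₂.1) (hM' x₁ h₁.2 x₂ h₂.2)
    _ = _ := by ring

theorem HolderNear.const_smul [NormedSpace ℂ G] {g : E → G} {ε : ℝ} {x : E}
    (hg : HolderNear g ε x) (c : ℂ) : HolderNear (c • g) ε x := by
  obtain ⟨O, M, hO, hx, hM⟩ := hg
  refine ⟨O, ‖c‖ * M, hO, hx, fun x₁ h₁ x₂ h₂ ↦ ?_⟩
  rw [Pi.smul_apply, Pi.smul_apply, ← smul_sub, norm_smul, mul_assoc]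
  gcongr
  exact hM x₁ h₁ x₂ h₂

theorem ContDiffAt.holderNear [NormedSpace ℝ E] [NormedSpace ℝ G] {g : E → G} {ε : ℝ} {x : E}
    (hg : ContDiffAt ℝ 1 g x) (hε : ε ≤ 1) : HolderNear g ε x := by
  obtain ⟨K, t, ht, hK⟩ := hg.exists_lipschitzOnWith
  obtain ⟨δ, hδ, hδt⟩ := Metric.mem_nhds_iff.1 ht
  refine ⟨ball x (min δ (1 / 2)), K, isOpen_ball, mem_ball_self (by positivity),
    fun x₁ h₁ x₂ h₂ ↦ ?_⟩
  refine (hK.norm_sub_le (hδt (ball_subset_ball (min_le_left _ _) h₁))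
    (hδt (ball_subset_ball (min_le_left _ _) h₂))).trans ?_
  have h₁' : Dist.dist x₁ x < 1 / 2 := ball_subset_ball (min_le_right _ _) h₁
  have h₂' : Dist.dist x₂ x < 1 / 2 := ball_subset_ball (min_le_right _ _) h₂
  have hd : ‖x₁ - x₂‖ ≤ 1 := by
    rw [← dist_eq_norm]
    linarith [dist_triangle_right x₁ x₂ x]
  rcases (norm_nonneg (x₁ - x₂)).eq_or_lt with h0 | h0
  · rw [← h0]
    simpa using mul_nonneg K.coe_nonneg (Real.rpow_nonneg le_rfl ε)
  · gcongr
    exact Real.self_le_rpow_of_le_one h0.le hd hε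

end Holder

section MainEstimate

variable {E : Type*} [NormedAddCommGroup E] [InnerProductSpace ℝ E] [FiniteDimensional ℝ E]
  [MeasurableSpace E] [BorelSpace E] {μ : Measure E}

omit [BorelSpace E] in
theorem holderNear_integral_nearKernel {G : Type*} [NormedAddCommGroup G] [NormedSpace ℝ G]
    [NormedSpace ℂ G] {χ : ContDiffBump (0 : E)} {β : ℂ} (hk : Integrable (nearKernel χ β) μ)
    {g : E → G} (hg : ∀ x, Integrable (fun y ↦ nearKernel χ β y • g (x - y)) μ) {ε M r : ℝ}
    {x : E} (hr : 0 < r)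
    (hM : ∀ x₁ ∈ ball x (r + χ.rOut), ∀ x₂ ∈ ball x (r + χ.rOut),
      ‖g x₁ - g x₂‖ ≤ M * ‖x₁ - x₂‖ ^ ε) :
    HolderNear (fun x ↦ ∫ y, nearKernel χ β y • g (x - y) ∂μ) ε x := by
  refine ⟨ball x r, (∫ y, ‖nearKernel χ β y‖ ∂μ) * M, isOpen_ball, mem_ball_self hr,
    fun x₁ h₁ x₂ h₂ ↦ ?_⟩
  rw [← integral_sub (hg x₁) (hg x₂), mul_assoc, ← integral_mul_const]
  refine norm_integral_le_of_norm_le (hk.norm.mul_const _) (ae_of_all _ fun y ↦ ?_)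
  rcases le_or_gt χ.rOut ‖y‖ with hy | hy
  · simp [nearKernel_eq_zero χ hy]
  · have hmem : ∀ z ∈ ball x r, z - y ∈ ball x (r + χ.rOut) := fun z hz ↦ by
      rw [mem_ball_iff_norm] at hz ⊢
      calc ‖z - y - x‖ = ‖(z - x) - y‖ := by congr 1; abel
        _ ≤ ‖z - x‖ + ‖y‖ := norm_sub_le _ _
        _ < _ := by linarith
    rw [← smul_sub, norm_smul]
    gcongr
    simpa using hM _ (hmem x₁ h₁) _ (hmem x₂ h₂)

variable [μ.IsAddHaarMeasure]

theorem contDiff_and_holderNear_integral_mul_norm_cpow {f : E → ℂ} {a : ℝ} {l : ℕ} {β : ℂ}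
    (hd : 1 ≤ Module.finrank ℝ E) (hf : ContDiff ℝ l f)
    (hdecay : f =O[cocompact E] fun y ↦ ‖y‖ ^ (-a))
    (hβ₀ : -(Module.finrank ℝ E : ℝ) < β.re) (hβ₁ : β.re + Module.finrank ℝ E < a) :
    ContDiff ℝ l (fun x ↦ ∫ y, f y * (‖x - y‖ : ℂ) ^ β ∂μ) ∧
    ∀ (x : E) (ε : ℝ), ε ≤ 1 → HolderNear (iteratedFDeriv ℝ l f) ε x →
      HolderNear (iteratedFDeriv ℝ l (fun x ↦ ∫ y, f y * (‖x - y‖ : ℂ) ^ β ∂μ)) ε x := by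
  obtain ⟨C, hC⟩ := exists_norm_le_mul_one_add_norm_rpow hf.continuous hdecay
  have hsplit : ∀ χ : ContDiffBump (0 : E), (fun x ↦ ∫ y, f y * (‖x - y‖ : ℂ) ^ β ∂μ) =
      (fun x ↦ ∫ y, nearKernel χ β y • f (x - y) ∂μ) +
        fun x ↦ ∫ y, f y • farKernel χ β (x - y) ∂μ := fun χ ↦ funext <|
    integral_mul_norm_cpow_eq χ hf (integrable_nearKernel χ hd hβ₀)
      (dominatedTranslates_farKernel χ l hC hβ₁)
  have hnear := fun χ : ContDiffBump (0 : E) ↦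
    (dominatedTranslates_nearKernel χ hf (integrable_nearKernel (μ := μ) χ hd hβ₀)
      ).hasFTaylorSeriesUpTo_integral (integrable_nearKernel χ hd hβ₀).aestronglyMeasurable hf
  have hnear' : ∀ χ : ContDiffBump (0 : E),
      ContDiff ℝ l (fun x ↦ ∫ y, nearKernel χ β y • f (x - y) ∂μ) := fun χ ↦
    HasFTaylorSeriesUpTo.contDiff (n := l) (hnear χ)
  have hfar : ∀ (χ : ContDiffBump (0 : E)) (N : ℕ),
      ContDiff ℝ N (fun x ↦ ∫ y, f y • farKernel χ β (x - y) ∂μ) := fun χ N ↦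
    HasFTaylorSeriesUpTo.contDiff (n := N) <|
      (dominatedTranslates_farKernel χ N hC hβ₁).hasFTaylorSeriesUpTo_integral
        hf.continuous.aestronglyMeasurable (contDiff_farKernel (k := N) χ β)
  constructor
  · rw [hsplit ⟨1, 2, one_pos, one_lt_two⟩]
    exact (hnear' _).add (hfar _ l)
  · rintro x ε hε ⟨O, M, hO, hx, hM⟩
    obtain ⟨δ, hδ, hδO⟩ := Metric.isOpen_iff.1 hO x hx
    let χ : ContDiffBump (0 : E) := ⟨δ / 4, δ / 2, by positivity, by linarith⟩
    have hball : ball x (δ / 2 + χ.rOut) ⊆ O := by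
      rwa [show δ / 2 + χ.rOut = δ from add_halves δ]
    have hk := integrable_nearKernel (μ := μ) χ hd hβ₀
    rw [hsplit χ, iteratedFDeriv_add (hnear' χ) (hfar χ l)]
    refine HolderNear.add ?_ ?_
    · rw [show iteratedFDeriv ℝ l (fun x ↦ ∫ y, nearKernel χ β y • f (x - y) ∂μ) =
          fun x ↦ ∫ y, nearKernel χ β y • iteratedFDeriv ℝ l f (x - y) ∂μ from
        funext fun z ↦ ((hnear χ).eq_iteratedFDeriv le_rfl z).symm]
      exact holderNear_integral_nearKernel hk
        ((dominatedTranslates_nearKernel χ hf hk).integrable_iteratedFDeriv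
          hk.aestronglyMeasurable hf le_rfl) (half_pos hδ)
        fun x₁ h₁ x₂ h₂ ↦ hM x₁ (hball h₁) x₂ (hball h₂)
    · refine ContDiffAt.holderNear (ContDiff.contDiffAt ?_) hε
      exact (hfar χ (l + 1)).iteratedFDeriv_right (by push_cast; rw [add_comm])

end MainEstimate

theorem stmt_9 (a : ℝ) (ha : 0 < a) (l : ℕ) (n : ℕ) (hn : 0 < n)
    (f : EuclideanSpace ℝ (Fin n) → ℂ) (hf : ContDiff ℝ l f)
    (hdecay : f =O[cocompact (EuclideanSpace ℝ (Fin n))] fun y => ‖y‖ ^ (-a))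
    (α : ℂ) (hα0 : 0 < α.re) (hα1 : α.re < a)
    (hαpole : ∀ m : ℕ, α ≠ (n : ℂ) + 2 * m) :
    ContDiff ℝ l (riesz n f α) ∧
    ∀ (x : EuclideanSpace ℝ (Fin n)) (ε : ℝ), 0 < ε → ε < 1 →
      (∃ (O : Set (EuclideanSpace ℝ (Fin n))) (M : ℝ), IsOpen O ∧ x ∈ O ∧
        ∀ x₁ ∈ O, ∀ x₂ ∈ O,
          ‖iteratedFDeriv ℝ l f x₁ - iteratedFDeriv ℝ l f x₂‖ ≤ M * ‖x₁ - x₂‖ ^ ε) →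
      ∃ (O' : Set (EuclideanSpace ℝ (Fin n))) (M' : ℝ), IsOpen O' ∧ x ∈ O' ∧
        ∀ x₁ ∈ O', ∀ x₂ ∈ O',
          ‖iteratedFDeriv ℝ l (riesz n f α) x₁ - iteratedFDeriv ℝ l (riesz n f α) x₂‖ ≤
            M' * ‖x₁ - x₂‖ ^ ε := by
  have hfin : Module.finrank ℝ (EuclideanSpace ℝ (Fin n)) = n := finrank_euclideanSpace_fin
  have hre : (α - n).re = α.re - n := by simp
  obtain ⟨hsmooth, hholder⟩ := contDiff_and_holderNear_integral_mul_norm_cpow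
    (μ := (volume : Measure (EuclideanSpace ℝ (Fin n)))) (β := α - n) (by rw [hfin]; exact hn)
    hf hdecay (by rw [hfin, hre]; linarith) (by rw [hfin, hre]; linarith)
  have hriesz : riesz n f α = (Hfun n α)⁻¹ •
      fun x : EuclideanSpace ℝ (Fin n) ↦ ∫ y, f y * (‖x - y‖ : ℂ) ^ (α - n) := rfl
  rw [hriesz]
  refine ⟨contDiff_const.smul hsmooth, fun x ε _ hε₁ h ↦ ?_⟩
  have h' := (hholder x ε hε₁.le h).const_smul (Hfun n α)⁻¹
  rwa [show (Hfun n α)⁻¹ • iteratedFDeriv ℝ l (fun x : EuclideanSpace ℝ (Fin n) ↦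
      ∫ y, f y * (‖x - y‖ : ℂ) ^ (α - n)) = iteratedFDeriv ℝ l ((Hfun n α)⁻¹ •
        fun x : EuclideanSpace ℝ (Fin n) ↦ ∫ y, f y * (‖x - y‖ : ℂ) ^ (α - n)) from
    funext fun z ↦ (iteratedFDeriv_const_smul_apply hsmooth.contDiffAt).symm] at h'
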